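/- arXiv:1507.02775 — 2 statements merged into one kernel-verified Lean document; each statement's English description precedes it below -/
import Mathlib

section
/- (Lemma 2.2: L⁴-bounds for bulk minimizers, Dirichlet case.) Let b > 0, R > 0, let E be a real number and C₀ ≥ 0. Assume: (i) E_blk(v; b, R) ≥ R²E for every v in the Dirichlet class D_R; (ii) u belongs to D_R, is C² on Q_R, satisfies −b(∇−iA₀)²u = (1 − |u|²)u in Q_R, and E_blk(u; b, R) ≤ R²E + C₀R (i.e. u is an approximate minimizer attaining the Dirichlet ground-state energy up to the Frank–Kachmar error). Then −2R²E − 2C₀R ≤ ∫_{Q_R}|u|⁴ dx ≤ −2R²E. -/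
open MeasureTheory

noncomputable section

/-- The vector potential `A₀(x₁,x₂) = (−x₂/2, x₁/2)`, generating a unit magnetic field. -/
def A0 (x : ℝ × ℝ) : ℝ × ℝ := (-x.2 / 2, x.1 / 2)

/-- `|(∇−iA₀)u|²`, the squared modulus of the magnetic gradient of `u`. -/
def magGradSq (u : ℝ × ℝ → ℂ) (x : ℝ × ℝ) : ℝ :=
  ‖fderiv ℝ u x (1, 0) - Complex.I * ((A0 x).1 : ℂ) * u x‖ ^ 2 +
  ‖fderiv ℝ u x (0, 1) - Complex.I * ((A0 x).2 : ℂ) * u x‖ ^ 2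

/-- The open square `Q_R = (−R/2,R/2) × (−R/2,R/2)`. -/
def QR (R : ℝ) : Set (ℝ × ℝ) := Set.Ioo (-R / 2) (R / 2) ×ˢ Set.Ioo (-R / 2) (R / 2)

/-- The bulk energy `E_blk(u;b,R) = ∫_{Q_R} (b|(∇−iA₀)u|² − |u|² + ½|u|⁴)`. -/
def Eblk (u : ℝ × ℝ → ℂ) (b R : ℝ) : ℝ :=
  ∫ x in QR R, (b * magGradSq u x - ‖u x‖ ^ 2 + (1 / 2) * ‖u x‖ ^ 4)

/-- The linear energy `E_lin(u;b,R) = ∫_{Q_R} (b|(∇−iA₀)u|² − |u|²)`. -/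
def Elin (u : ℝ × ℝ → ℂ) (b R : ℝ) : ℝ :=
  ∫ x in QR R, (b * magGradSq u x - ‖u x‖ ^ 2)

/-- The Dirichlet class `D_R`: functions `C¹` on the closure of `Q_R` vanishing on `∂Q_R`. -/
def DirichletClass (u : ℝ × ℝ → ℂ) (R : ℝ) : Prop :=
  ContDiffOn ℝ 1 u (closure (QR R)) ∧ ∀ x ∈ frontier (QR R), u x = 0

/-- The Neumann class `N_R`: functions `C¹` on the closure of `Q_R`. -/
def NeumannClass (u : ℝ × ℝ → ℂ) (R : ℝ) : Prop :=
  ContDiffOn ℝ 1 u (closure (QR R))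

/-- The magnetic Laplacian `(∇−iA₀)²u = Δu − 2i A₀·∇u − |A₀|²u` (using `div A₀ = 0`). -/
def magLap (u : ℝ × ℝ → ℂ) (x : ℝ × ℝ) : ℂ :=
  (fderiv ℝ (fun y => fderiv ℝ u y (1, 0)) x (1, 0) +
   fderiv ℝ (fun y => fderiv ℝ u y (0, 1)) x (0, 1))
  - 2 * Complex.I * (((A0 x).1 : ℂ) * fderiv ℝ u x (1, 0) +
                     ((A0 x).2 : ℂ) * fderiv ℝ u x (0, 1))
  - (((A0 x).1 ^ 2 + (A0 x).2 ^ 2 : ℝ) : ℂ) * u x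

/-- The constrained Dirichlet ground-state energy
`m^D(b,R) = inf { E_lin(u;b,R) / (∫_{Q_R}|u|⁴)^{1/2} : u ∈ D_R, u ≠ 0 }`. -/
def mD (b R : ℝ) : ℝ :=
  sInf {m : ℝ | ∃ u : ℝ × ℝ → ℂ, DirichletClass u R ∧ u ≠ 0 ∧
    m = Elin u b R / Real.sqrt (∫ x in QR R, ‖u x‖ ^ 4)}

/-- The constrained Neumann ground-state energy
`m^N(b,R) = inf { E_lin(u;b,R) / (∫_{Q_R}|u|⁴)^{1/2} : u ∈ N_R, u ≠ 0 }`. -/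
def mN (b R : ℝ) : ℝ :=
  sInf {m : ℝ | ∃ u : ℝ × ℝ → ℂ, NeumannClass u R ∧ u ≠ 0 ∧
    m = Elin u b R / Real.sqrt (∫ x in QR R, ‖u x‖ ^ 4)}

/-- The outward unit normal of the square `Q_R` (at non-corner boundary points). -/
def nuSq (R : ℝ) (x : ℝ × ℝ) : ℝ × ℝ :=
  (if x.1 = R / 2 then 1 else if x.1 = -R / 2 then -1 else 0,
   if x.2 = R / 2 then 1 else if x.2 = -R / 2 then -1 else 0)

/-- The corner points of the square `Q_R`. -/
def IsCornerPt (R : ℝ) (x : ℝ × ℝ) : Prop :=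
  (x.1 = R / 2 ∨ x.1 = -R / 2) ∧ (x.2 = R / 2 ∨ x.2 = -R / 2)

/-- The magnetic Neumann boundary condition `ν·(∇−iA₀)u = 0` at non-corner points of `∂Q_R`. -/
def MagNeumannBC (u : ℝ × ℝ → ℂ) (R : ℝ) : Prop :=
  ∀ x ∈ frontier (QR R), ¬ IsCornerPt R x →
    ((nuSq R x).1 : ℂ) * (fderiv ℝ u x (1, 0) - Complex.I * ((A0 x).1 : ℂ) * u x) +
    ((nuSq R x).2 : ℂ) * (fderiv ℝ u x (0, 1) - Complex.I * ((A0 x).2 : ℂ) * u x) = 0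

theorem isOpen_QR (R : ℝ) : IsOpen (QR R) :=
  isOpen_Ioo.prod isOpen_Ioo

theorem closure_QR {R : ℝ} (hR : 0 < R) :
    closure (QR R) = Set.Icc (-R / 2, -R / 2) (R / 2, R / 2) := by
  have h : -R / 2 ≠ R / 2 := by linarith
  rw [QR, closure_prod_eq, closure_Ioo h, Set.Icc_prod_eq]

theorem QR_ae_eq_closure {R : ℝ} (hR : 0 < R) :
    QR R =ᵐ[volume] closure (QR R) := by
  rw [closure_QR hR, Set.Icc_prod_eq]
  exact Measure.set_prod_ae_eq Ioo_ae_eq_Icc Ioo_ae_eq_Icc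

theorem uniqueDiffOn_closure_QR {R : ℝ} (hR : 0 < R) : UniqueDiffOn ℝ (closure (QR R)) := by
  have h : -R / 2 < R / 2 := by linarith
  rw [closure_QR hR, Set.Icc_prod_eq]
  exact (uniqueDiffOn_Icc h).prod (uniqueDiffOn_Icc h)

theorem mem_frontier_QR {R : ℝ} (hR : 0 < R) {x : ℝ × ℝ}
    (hx : x ∈ Set.Icc ((-R / 2, -R / 2) : ℝ × ℝ) (R / 2, R / 2)) (hx' : x ∉ QR R) :
    x ∈ frontier (QR R) := by
  rw [(isOpen_QR R).frontier_eq, closure_QR hR]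
  exact ⟨hx, hx'⟩

theorem fderivWithin_closure_QR {R : ℝ} (u : ℝ × ℝ → ℂ) {x : ℝ × ℝ} (hx : x ∈ QR R) :
    fderivWithin ℝ u (closure (QR R)) x = fderiv ℝ u x :=
  fderivWithin_of_mem_nhds (Filter.mem_of_superset ((isOpen_QR R).mem_nhds hx) subset_closure)

theorem integrableOn_QR_of_eqOn {R : ℝ} (hR : 0 < R) {f g : ℝ × ℝ → ℝ}
    (hg : ContinuousOn g (closure (QR R))) (hfg : Set.EqOn f g (QR R)) :
    IntegrableOn f (QR R) := by
  refine IntegrableOn.congr_fun ?_ hfg.symm (isOpen_QR R).measurableSet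
  refine IntegrableOn.mono_set ?_ subset_closure
  refine hg.integrableOn_compact ?_
  rw [closure_QR hR]
  exact isCompact_Icc

theorem integrableOn_magGradSq {R : ℝ} (hR : 0 < R) {u : ℝ × ℝ → ℂ}
    (hu : ContDiffOn ℝ 1 u (closure (QR R))) : IntegrableOn (magGradSq u) (QR R) := by
  have hc := hu.continuousOn
  have hd := hu.continuousOn_fderivWithin (uniqueDiffOn_closure_QR hR) le_rfl
  have hd₁ := hd.clm_apply (continuousOn_const (c := ((1, 0) : ℝ × ℝ)))
  have hd₂ := hd.clm_apply (continuousOn_const (c := ((0, 1) : ℝ × ℝ)))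
  refine integrableOn_QR_of_eqOn hR (g := fun x =>
    ‖fderivWithin ℝ u (closure (QR R)) x (1, 0) - Complex.I * ((A0 x).1 : ℂ) * u x‖ ^ 2 +
    ‖fderivWithin ℝ u (closure (QR R)) x (0, 1) - Complex.I * ((A0 x).2 : ℂ) * u x‖ ^ 2) ?_ ?_
  · simp only [A0]
    fun_prop
  · intro x hx
    simp only [magGradSq, fderivWithin_closure_QR u hx]

/-- `Re(ū ∂ᵥu)`, with the derivative taken within the closed square so that it is
continuous up to the boundary. -/
def densityFlux (u : ℝ × ℝ → ℂ) (R : ℝ) (v x : ℝ × ℝ) : ℝ :=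
  inner ℝ (u x) (fderivWithin ℝ u (closure (QR R)) x v)

theorem continuousOn_densityFlux {R : ℝ} (hR : 0 < R) {u : ℝ × ℝ → ℂ}
    (hu : ContDiffOn ℝ 1 u (closure (QR R))) (v : ℝ × ℝ) :
    ContinuousOn (densityFlux u R v) (closure (QR R)) :=
  hu.continuousOn.inner ((hu.continuousOn_fderivWithin (uniqueDiffOn_closure_QR hR)
    le_rfl).clm_apply continuousOn_const)

theorem hasFDerivAt_densityFlux {R : ℝ} {u : ℝ × ℝ → ℂ} (hu : ContDiffOn ℝ 2 u (QR R))
    (v : ℝ × ℝ) {x : ℝ × ℝ} (hx : x ∈ QR R) :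
    HasFDerivAt (densityFlux u R v) ((fderivInnerCLM ℝ (u x, fderiv ℝ u x v)).comp
      ((fderiv ℝ u x).prod (fderiv ℝ (fun y => fderiv ℝ u y v) x))) x := by
  have hux : ContDiffAt ℝ 2 u x := hu.contDiffAt ((isOpen_QR R).mem_nhds hx)
  have h₁ : HasFDerivAt u (fderiv ℝ u x) x := (hux.differentiableAt two_ne_zero).hasFDerivAt
  have h₂ : DifferentiableAt ℝ (fun y => fderiv ℝ u y v) x :=
    ((hux.fderiv_right (m := 1) (by norm_num)).differentiableAt one_ne_zero).clm_apply
      (differentiableAt_const v)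
  refine (h₁.inner ℝ h₂.hasFDerivAt).congr_of_eventuallyEq ?_
  filter_upwards [(isOpen_QR R).mem_nhds hx] with y hy
  rw [densityFlux, fderivWithin_closure_QR u hy]

/-- The divergence of `Re(ū∇u)` is `|(∇−iA₀)u|² + Re(ū(∇−iA₀)²u)`. -/
theorem inner_laplacian_add_norm_sq_grad (u : ℝ × ℝ → ℂ) (x : ℝ × ℝ) :
    (inner ℝ (u x) (fderiv ℝ (fun y => fderiv ℝ u y (1, 0)) x (1, 0)) +
        inner ℝ (fderiv ℝ u x (1, 0)) (fderiv ℝ u x (1, 0))) +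
      (inner ℝ (u x) (fderiv ℝ (fun y => fderiv ℝ u y (0, 1)) x (0, 1)) +
        inner ℝ (fderiv ℝ u x (0, 1)) (fderiv ℝ u x (0, 1))) =
      magGradSq u x + inner ℝ (u x) (magLap u x) := by
  simp only [magGradSq, magLap, Complex.inner, ← Complex.normSq_eq_norm_sq, Complex.normSq_apply]
  simp [pow_two]
  ring

theorem inner_magLap_of_eulerLagrange {b : ℝ} {u : ℝ × ℝ → ℂ} {x : ℝ × ℝ}
    (h : -(b : ℂ) * magLap u x = ((1 - ‖u x‖ ^ 2 : ℝ) : ℂ) * u x) :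
    b * inner ℝ (u x) (magLap u x) = -‖u x‖ ^ 2 + ‖u x‖ ^ 4 := by
  have h' : b • magLap u x = (-(1 - ‖u x‖ ^ 2)) • u x := by
    rw [Complex.real_smul, Complex.real_smul, Complex.ofReal_neg, neg_mul, ← h]
    ring
  rw [← real_inner_smul_right, h', real_inner_smul_right, real_inner_self_eq_norm_sq]
  ring

theorem densityFlux_eq_zero {R : ℝ} {u : ℝ × ℝ → ℂ} {v x : ℝ × ℝ} (hx : u x = 0) :
    densityFlux u R v x = 0 := by
  rw [densityFlux, hx, inner_zero_left]

/-- A Dirichlet solution of the Ginzburg–Landau equation satisfies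
`∫ (b|(∇−iA₀)u|² − |u|² + |u|⁴) = 0`. -/
theorem integral_energy_identity {b R : ℝ} (hb : 0 < b) (hR : 0 < R) {u : ℝ × ℝ → ℂ}
    (hu : DirichletClass u R) (hu2 : ContDiffOn ℝ 2 u (QR R))
    (hEL : ∀ x ∈ QR R, -(b : ℂ) * magLap u x = ((1 - ‖u x‖ ^ 2 : ℝ) : ℂ) * u x) :
    ∫ x in QR R, (b * magGradSq u x - ‖u x‖ ^ 2 + ‖u x‖ ^ 4) = 0 := by
  have hc := hu.1.continuousOn
  let f' : ℝ × ℝ → ℝ × ℝ → ℝ × ℝ →L[ℝ] ℝ := fun v x =>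
    (fderivInnerCLM ℝ (u x, fderiv ℝ u x v)).comp
      ((fderiv ℝ u x).prod (fderiv ℝ (fun y => fderiv ℝ u y v) x))
  have hdiv : ∀ x ∈ QR R, b * magGradSq u x - ‖u x‖ ^ 2 + ‖u x‖ ^ 4 =
      b * (f' (1, 0) x (1, 0) + f' (0, 1) x (0, 1)) := by
    intro x hx
    have h₁ := inner_laplacian_add_norm_sq_grad u x
    have h₂ := inner_magLap_of_eulerLagrange (hEL x hx)
    simp only [f', ContinuousLinearMap.comp_apply, ContinuousLinearMap.prod_apply,
      fderivInnerCLM_apply]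
    rw [h₁, mul_add, h₂]
    ring
  have hint : IntegrableOn (fun x => b * magGradSq u x - ‖u x‖ ^ 2 + ‖u x‖ ^ 4) (QR R) :=
    (((integrableOn_magGradSq hR hu.1).const_mul b).sub
      (integrableOn_QR_of_eqOn hR (hc.norm.pow 2) fun _ _ => rfl)).add
      (integrableOn_QR_of_eqOn hR (hc.norm.pow 4) fun _ _ => rfl)
  have hint' : IntegrableOn (fun x => f' (1, 0) x (1, 0) + f' (0, 1) x (0, 1)) (QR R) := by
    refine IntegrableOn.congr_fun (hint.const_mul b⁻¹) (fun x hx => ?_)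
      (isOpen_QR R).measurableSet
    simp only [hdiv x hx]
    field_simp
  have hae := QR_ae_eq_closure hR
  have hbdry : ∀ s ∈ Set.uIcc (-R / 2) (R / 2), u (s, R / 2) = 0 ∧ u (s, -R / 2) = 0 ∧
      u (R / 2, s) = 0 ∧ u (-R / 2, s) = 0 := by
    intro s hs
    rw [Set.uIcc_of_le (by linarith)] at hs
    obtain ⟨hs₁, hs₂⟩ := hs
    refine ⟨?_, ?_, ?_, ?_⟩ <;> refine hu.2 _ (mem_frontier_QR hR ?_ ?_) <;>
      simp only [QR, Set.mem_Icc, Prod.mk_le_mk, Set.mem_prod, Set.mem_Ioo, lt_irrefl, and_false,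
        false_and, not_false_eq_true] <;>
      refine ⟨⟨?_, ?_⟩, ?_, ?_⟩ <;> linarith
  have hstokes := integral_divergence_prod_Icc_of_hasFDerivAt_of_le
    (densityFlux u R (1, 0)) (densityFlux u R (0, 1)) (f' (1, 0)) (f' (0, 1))
    (-R / 2, -R / 2) (R / 2, R / 2) (Prod.mk_le_mk.2 ⟨by linarith, by linarith⟩)
    (closure_QR hR ▸ continuousOn_densityFlux hR hu.1 _)
    (closure_QR hR ▸ continuousOn_densityFlux hR hu.1 _)
    (fun x hx => hasFDerivAt_densityFlux hu2 _ hx) (fun x hx => hasFDerivAt_densityFlux hu2 _ hx)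
    (closure_QR hR ▸ hint'.congr_set_ae hae.symm)
  have hzero : ∀ {g : ℝ → ℝ}, (∀ s ∈ Set.uIcc (-R / 2) (R / 2), g s = 0) →
      ∫ s in (-R / 2)..(R / 2), g s = 0 := fun hg => by
    rw [intervalIntegral.integral_congr (g := fun _ => 0) hg, intervalIntegral.integral_zero]
  rw [hzero fun s hs => densityFlux_eq_zero (hbdry s hs).1,
    hzero fun s hs => densityFlux_eq_zero (hbdry s hs).2.1,
    hzero fun s hs => densityFlux_eq_zero (hbdry s hs).2.2.1,
    hzero fun s hs => densityFlux_eq_zero (hbdry s hs).2.2.2, ← closure_QR hR,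
    ← setIntegral_congr_set hae] at hstokes
  rw [setIntegral_congr_fun (isOpen_QR R).measurableSet hdiv, integral_const_mul, hstokes]
  simp

theorem Eblk_eq_of_eulerLagrange {b R : ℝ} (hb : 0 < b) (hR : 0 < R) {u : ℝ × ℝ → ℂ}
    (hu : DirichletClass u R) (hu2 : ContDiffOn ℝ 2 u (QR R))
    (hEL : ∀ x ∈ QR R, -(b : ℂ) * magLap u x = ((1 - ‖u x‖ ^ 2 : ℝ) : ℂ) * u x) :
    Eblk u b R = -(1 / 2) * ∫ x in QR R, ‖u x‖ ^ 4 := by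
  have hc := hu.1.continuousOn
  have hlin : IntegrableOn (fun x => b * magGradSq u x - ‖u x‖ ^ 2) (QR R) :=
    ((integrableOn_magGradSq hR hu.1).const_mul b).sub
      (integrableOn_QR_of_eqOn hR (hc.norm.pow 2) fun _ _ => rfl)
  have hquart : IntegrableOn (fun x => ‖u x‖ ^ 4) (QR R) :=
    integrableOn_QR_of_eqOn hR (hc.norm.pow 4) fun _ _ => rfl
  have h := integral_energy_identity hb hR hu hu2 hEL
  rw [integral_add hlin hquart] at h
  rw [Eblk, integral_add hlin (hquart.const_mul _), integral_const_mul]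
  linarith

/-- Lemma 2.2, Dirichlet case: `L⁴`-bounds for approximate bulk minimizers. -/
theorem L4_bounds_minimizer_dirichlet (b R E C₀ : ℝ) (hb : 0 < b) (hR : 0 < R)
    (hC₀ : 0 ≤ C₀)
    (hlow : ∀ v : ℝ × ℝ → ℂ, DirichletClass v R → Eblk v b R ≥ R ^ 2 * E)
    (u : ℝ × ℝ → ℂ) (hu : DirichletClass u R) (hu2 : ContDiffOn ℝ 2 u (QR R))
    (hEL : ∀ x ∈ QR R, -(b : ℂ) * magLap u x = ((1 - ‖u x‖ ^ 2 : ℝ) : ℂ) * u x)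
    (hmin : Eblk u b R ≤ R ^ 2 * E + C₀ * R) :
    -2 * R ^ 2 * E - 2 * C₀ * R ≤ (∫ x in QR R, ‖u x‖ ^ 4) ∧
    (∫ x in QR R, ‖u x‖ ^ 4) ≤ -2 * R ^ 2 * E := by
  have h := Eblk_eq_of_eulerLagrange hb hR hu hu2 hEL
  have hE := hlow u hu
  constructor <;> linarith
end
end

section
/- (Upper bound of Theorem 1.1, Dirichlet case, quantitative per-R form.) Let b > 0, R > 0, E < 0 a real number and C₀ ≥ 0 with R > C₀/(−E). Suppose u belongs to the Dirichlet class D_R, is C² on Q_R, satisfies −b(∇−iA₀)²u = (1 − |u|²)u in Q_R, and E_blk(u; b, R) ≤ R²E + C₀R. Then ∫_{Q_R}|u|⁴ dx > 0 and E_lin(u; b, R) ≤ (−R·√(−2E) + 2C₀·(−2E)^{−1/2})·(∫_{Q_R}|u|⁴ dx)^{1/2}. In particular the constrained Dirichlet ground-state energy m^D(b,R) = inf{ E_lin(v;b,R)/(∫_{Q_R}|v|⁴)^{1/2} : v ∈ D_R, v ≠ 0 } satisfies m^D(b,R) ≤ −R√(−2E) + 2C₀(−2E)^{−1/2}. -/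
open MeasureTheory

noncomputable section

theorem volume_real_QR {R : ℝ} (hR : 0 < R) : (volume : Measure (ℝ × ℝ)).real (QR R) = R ^ 2 := by
  rw [QR, Measure.volume_eq_prod, measureReal_prod_prod, Real.volume_real_Ioo_of_le (by linarith)]
  ring

theorem volume_QR_ne_top (R : ℝ) : (volume : Measure (ℝ × ℝ)) (QR R) ≠ ⊤ := by
  rw [QR, Measure.volume_eq_prod, Measure.prod_prod, Real.volume_Ioo]
  exact ENNReal.mul_ne_top ENNReal.ofReal_ne_top ENNReal.ofReal_ne_top

theorem isCompact_closure_QR (R : ℝ) : IsCompact (closure (QR R)) := by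
  rw [QR, closure_prod_eq]
  exact (Metric.isBounded_Ioo _ _).isCompact_closure.prod
    (Metric.isBounded_Ioo _ _).isCompact_closure

theorem DirichletClass.integrableOn_norm_pow {u : ℝ × ℝ → ℂ} {R : ℝ} (hu : DirichletClass u R)
    (n : ℕ) : IntegrableOn (fun x => ‖u x‖ ^ n) (QR R) :=
  ((hu.1.continuousOn.norm.pow n).integrableOn_compact (isCompact_closure_QR R)).mono_set
    subset_closure

/-- The Cauchy–Schwarz inequality against the constant `1` on `Q_R`. -/
theorem DirichletClass.integral_norm_sq_le {u : ℝ × ℝ → ℂ} {R : ℝ} (hu : DirichletClass u R)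
    (hR : 0 < R) : ∫ x in QR R, ‖u x‖ ^ 2 ≤ R * √(∫ x in QR R, ‖u x‖ ^ 4) := by
  have h2 := hu.integrableOn_norm_pow 2
  have h4 := hu.integrableOn_norm_pow 4
  set M := ∫ x in QR R, ‖u x‖ ^ 2
  set P := ∫ x in QR R, ‖u x‖ ^ 4
  have hconst (c : ℝ) : IntegrableOn (fun _ => c) (QR R) := integrableOn_const (volume_QR_ne_top R)
  have hsq : 0 ≤ P - 2 * (M / R ^ 2) * M + R ^ 2 * (M / R ^ 2) ^ 2 := by
    calc (0 : ℝ) ≤ ∫ x in QR R, (‖u x‖ ^ 2 - M / R ^ 2) ^ 2 := integral_nonneg fun x => sq_nonneg _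
      _ = ∫ x in QR R, (‖u x‖ ^ 4 - 2 * (M / R ^ 2) * ‖u x‖ ^ 2 + (M / R ^ 2) ^ 2) := by
        congr 1
        ext x
        ring
      _ = _ := by
        have hsub : IntegrableOn (fun x => ‖u x‖ ^ 4 - 2 * (M / R ^ 2) * ‖u x‖ ^ 2) (QR R) :=
          h4.sub (h2.const_mul _)
        rw [integral_add hsub (hconst _), integral_sub h4 (h2.const_mul _), integral_const_mul, setIntegral_const,
          volume_real_QR hR, smul_eq_mul]
  have hMP : M ^ 2 ≤ R ^ 2 * P := by
    field_simp at hsq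
    linarith
  have hM : M ≤ √(R ^ 2 * P) := Real.le_sqrt_of_sq_le hMP
  rwa [Real.sqrt_mul (sq_nonneg R), Real.sqrt_sq hR.le] at hM

theorem magGradSq_nonneg (u : ℝ × ℝ → ℂ) (x : ℝ × ℝ) : 0 ≤ magGradSq u x := by
  unfold magGradSq
  positivity

theorem DirichletClass.neg_mul_sqrt_le_Elin {u : ℝ × ℝ → ℂ} {b R : ℝ} (hu : DirichletClass u R)
    (hb : 0 < b) (hR : 0 < R) : -(R * √(∫ x in QR R, ‖u x‖ ^ 4)) ≤ Elin u b R := by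
  by_cases hint : IntegrableOn (fun x => b * magGradSq u x - ‖u x‖ ^ 2) (QR R)
  · have hle : ∫ x in QR R, -‖u x‖ ^ 2 ≤ Elin u b R :=
      integral_mono (hu.integrableOn_norm_pow 2).neg hint fun x => by
        have := mul_nonneg hb.le (magGradSq_nonneg u x)
        beta_reduce
        linarith
    rw [integral_neg] at hle
    linarith [hu.integral_norm_sq_le hR]
  · rw [Elin, integral_undef hint]
    have := mul_nonneg hR.le (Real.sqrt_nonneg (∫ x in QR R, ‖u x‖ ^ 4))
    linarith

theorem DirichletClass.Eblk_eq_of_ne_zero {u : ℝ × ℝ → ℂ} {b R : ℝ} (hu : DirichletClass u R)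
    (h : Eblk u b R ≠ 0) : Eblk u b R = Elin u b R + (1 / 2) * ∫ x in QR R, ‖u x‖ ^ 4 := by
  have h4 : IntegrableOn (fun x => (1 / 2) * ‖u x‖ ^ 4) (QR R) :=
    (hu.integrableOn_norm_pow 4).const_mul _
  have hblk : IntegrableOn (fun x => b * magGradSq u x - ‖u x‖ ^ 2 + (1 / 2) * ‖u x‖ ^ 4) (QR R) :=
    Not.imp_symm integral_undef h
  have hlin : IntegrableOn (fun x => b * magGradSq u x - ‖u x‖ ^ 2) (QR R) :=
    (hblk.sub h4).congr (.of_forall fun x => by simp)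
  rw [Eblk, integral_add hlin h4, integral_const_mul, Elin]

theorem DirichletClass.mD_le {u : ℝ × ℝ → ℂ} {b R : ℝ} (hu : DirichletClass u R)
    (hb : 0 < b) (hR : 0 < R) (hu0 : u ≠ 0) :
    mD b R ≤ Elin u b R / √(∫ x in QR R, ‖u x‖ ^ 4) := by
  refine csInf_le ⟨-R, ?_⟩ ⟨u, hu, hu0, rfl⟩
  rintro _ ⟨v, hv, -, rfl⟩
  rcases (Real.sqrt_nonneg (∫ x in QR R, ‖v x‖ ^ 4)).eq_or_lt with h | h
  · rw [← h, div_zero]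
    linarith
  · rw [le_div_iff₀ h]
    linarith [hv.neg_mul_sqrt_le_Elin hb hR]

/-- Upper bound of Theorem 1.1, Dirichlet case, quantitative per-`R` form. -/
theorem dirichlet_upper_bound (b R E C₀ : ℝ) (hb : 0 < b) (hR : 0 < R) (hE : E < 0)
    (hC₀ : 0 ≤ C₀) (hRC : R > C₀ / (-E))
    (u : ℝ × ℝ → ℂ) (hu : DirichletClass u R) (hu2 : ContDiffOn ℝ 2 u (QR R))
    (hEL : ∀ x ∈ QR R, -(b : ℂ) * magLap u x = ((1 - ‖u x‖ ^ 2 : ℝ) : ℂ) * u x)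
    (hmin : Eblk u b R ≤ R ^ 2 * E + C₀ * R) :
    (0 < ∫ x in QR R, ‖u x‖ ^ 4) ∧
    Elin u b R ≤ (-R * Real.sqrt (-2 * E) + 2 * C₀ * (Real.sqrt (-2 * E))⁻¹) *
      Real.sqrt (∫ x in QR R, ‖u x‖ ^ 4) ∧
    mD b R ≤ -R * Real.sqrt (-2 * E) + 2 * C₀ * (Real.sqrt (-2 * E))⁻¹ := by
  have hCE : C₀ < R * -E := (div_lt_iff₀ (by linarith)).1 hRC
  have hneg : Eblk u b R < 0 := hmin.trans_lt (by nlinarith)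
  have hsplit := hu.Eblk_eq_of_ne_zero hneg.ne
  have hlower := hu.neg_mul_sqrt_le_Elin hb hR
  have hP : 0 < ∫ x in QR R, ‖u x‖ ^ 4 := by
    have hP0 : 0 ≤ ∫ x in QR R, ‖u x‖ ^ 4 := integral_nonneg fun x => by positivity
    refine hP0.lt_of_ne fun h => ?_
    rw [← h, Real.sqrt_zero] at hlower
    rw [← h] at hsplit
    linarith
  have hlin : Elin u b R ≤ (-R * √(-2 * E) + 2 * C₀ * (√(-2 * E))⁻¹) *
      √(∫ x in QR R, ‖u x‖ ^ 4) := by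
    have ht := Real.sq_sqrt hP.le
    have hs := Real.sq_sqrt (show 0 ≤ -2 * E by linarith)
    have hs0 : 0 < √(-2 * E) := Real.sqrt_pos.2 (by linarith)
    set t := √(∫ x in QR R, ‖u x‖ ^ 4)
    set s := √(-2 * E)
    -- the bound is a quadratic inequality in `t` with discriminant `-2 * p * (R * s - 2 * p) ≤ 0`
    set p := C₀ * s⁻¹ with hp
    have hps : p * s = C₀ := by
      rw [hp, mul_assoc, inv_mul_cancel₀ hs0.ne', mul_one]
    have hp0 : 0 ≤ p := by positivity
    have hpR : 2 * p ≤ R * s := by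
      refine le_of_mul_le_mul_right ?_ hs0
      nlinarith
    have hdisc : 0 ≤ p * (R * s - 2 * p) := mul_nonneg hp0 (by linarith)
    have hEs : E = -s ^ 2 / 2 := by linarith
    rw [mul_assoc, ← hp]
    rw [hsplit, ← ht, hEs, ← hps] at hmin
    nlinarith [sq_nonneg (t - (R * s - 2 * p))]
  have hu0 : u ≠ 0 := by
    rintro rfl
    simp at hP
  exact ⟨hP, hlin, (hu.mD_le hb hR hu0).trans ((div_le_iff₀ (Real.sqrt_pos.2 hP)).2 hlin)⟩
end
end
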